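/- Let X be any one of ℚ, ℤ, ℕ₀, ℚ ∪ {-∞}, ℤ ∪ {-∞}, ℕ₀ ∪ {-∞}, and let UT_2(X) be the subsemigroup of UT_2(𝕋) consisting of matrices whose entries on and above the main diagonal lie in X. Then UT_2(X) satisfies exactly the same semigroup identities as the bicyclic monoid ℬ and as UT_2(𝕋). -/

import Mathlib

/-- The tropical (max-plus) semiring `𝕋 = ℝ ∪ {-∞}`, with `⊕ = max` and `⊗ = +`. -/
abbrev TT : Type := WithBot ℝ

/-- Tropical (max-plus) multiplication of square matrices over `𝕋`:
`(A ⊗ B) i j = max_k (A i k + B k j)`. -/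
def tmul {ι : Type} [Fintype ι] (A B : Matrix ι ι TT) : Matrix ι ι TT :=
  fun i j => Finset.univ.sup fun k => A i k + B k j

/-- The image of a word under the semigroup homomorphism from the free semigroup `Σ⁺`
to tropical matrices determined by the letter assignment `a` (junk value on the empty word). -/
def evalWord {ι σ : Type} [Fintype ι] (a : σ → Matrix ι ι TT) : List σ → Matrix ι ι TT
  | [] => fun _ _ => ⊥
  | h :: t => t.foldl (fun M s => tmul M (a s)) (a h)

/-- A tropical matrix is upper triangular if all entries strictly below the diagonal are `-∞`. -/
def IsUT {n : ℕ} (A : Matrix (Fin n) (Fin n) TT) : Prop :=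
  ∀ i j : Fin n, j < i → A i j = ⊥

/-- Multiplication of the bicyclic monoid `ℬ = ℕ₀ × ℕ₀`:
`(a,b)(c,d) = (a - b + max(b,c), d - c + max(b,c))` (in `ℕ` written with truncated
subtraction as `(a + (max b c - b), d + (max b c - c))`, which agrees since `max b c ≥ b, c`). -/
def bmul (p q : ℕ × ℕ) : ℕ × ℕ :=
  (p.1 + (max p.2 q.1 - p.2), q.2 + (max p.2 q.1 - q.1))

/-- The image of a word under the semigroup homomorphism `Σ⁺ → ℬ` determined by the letter
assignment `a` (junk value on the empty word). -/
def evalWordB {σ : Type} (a : σ → ℕ × ℕ) : List σ → ℕ × ℕ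
  | [] => (0, 0)
  | h :: t => t.foldl (fun m s => bmul m (a s)) (a h)

/-- The copy of `ℚ` inside `𝕋 = ℝ ∪ {-∞}`. -/
def Srat : Set TT := {x | ∃ q : ℚ, x = ((q : ℝ) : TT)}

/-- The copy of `ℤ` inside `𝕋 = ℝ ∪ {-∞}`. -/
def Sint : Set TT := {x | ∃ m : ℤ, x = ((m : ℝ) : TT)}

/-- The copy of `ℕ₀` inside `𝕋 = ℝ ∪ {-∞}`. -/
def Snat : Set TT := {x | ∃ m : ℕ, x = ((m : ℝ) : TT)}

open Filter in
/-- `f` is eventually below every real number strictly above `x`. -/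
def EventuallyBelow (f : ℕ → TT) (x : TT) : Prop :=
  ∀ t : ℝ, x < t → ∀ᶠ n in atTop, f n < t

theorem eventuallyBelow_const (x : TT) : EventuallyBelow (fun _ => x) x :=
  fun _ ht => Filter.Eventually.of_forall fun _ => ht

theorem exists_coe_add_coe_le {x y : TT} {t : ℝ} (h : x + y < t) :
    ∃ a b : ℝ, x < a ∧ y < b ∧ a + b ≤ t := by
  induction x using WithBot.recBotCoe with
  | bot =>
    induction y using WithBot.recBotCoe with
    | bot => exact ⟨t, 0, WithBot.bot_lt_coe _, WithBot.bot_lt_coe _, by simp⟩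
    | coe y =>
      exact ⟨t - (y + 1), y + 1, WithBot.bot_lt_coe _, WithBot.coe_lt_coe.2 (by linarith),
        by linarith⟩
  | coe x =>
    induction y using WithBot.recBotCoe with
    | bot =>
      exact ⟨x + 1, t - (x + 1), WithBot.coe_lt_coe.2 (by linarith), WithBot.bot_lt_coe _,
        by linarith⟩
    | coe y =>
      have h' : x + y < t := by exact_mod_cast h
      exact ⟨x + (t - x - y) / 2, y + (t - x - y) / 2, WithBot.coe_lt_coe.2 (by linarith),
        WithBot.coe_lt_coe.2 (by linarith), by linarith⟩

theorem EventuallyBelow.add {f g : ℕ → TT} {x y : TT} (hf : EventuallyBelow f x)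
    (hg : EventuallyBelow g y) : EventuallyBelow (fun n => f n + g n) (x + y) := by
  intro t ht
  obtain ⟨a, b, ha, hb, hab⟩ := exists_coe_add_coe_le ht
  filter_upwards [hf a ha, hg b hb] with n h₁ h₂
  calc f n + g n ≤ f n + (b : TT) := by gcongr
    _ < (a : TT) + (b : TT) := WithBot.add_lt_add_right WithBot.coe_ne_bot h₁
    _ ≤ t := by exact_mod_cast hab

theorem EventuallyBelow.sup {ι : Type} [Fintype ι] {f : ι → ℕ → TT} {x : ι → TT}
    (h : ∀ i, EventuallyBelow (f i) (x i)) :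
    EventuallyBelow (fun n => Finset.univ.sup fun i => f i n) (Finset.univ.sup x) := by
  intro t ht
  rw [Finset.sup_lt_iff (WithBot.bot_lt_coe t)] at ht
  filter_upwards [Filter.eventually_all.2 fun i => h i t (ht i (Finset.mem_univ i))] with n hn
  exact (Finset.sup_lt_iff (WithBot.bot_lt_coe t)).2 fun i _ => hn i

theorem evalWord_singleton {ι σ : Type} [Fintype ι] (a : σ → Matrix ι ι TT) (s : σ) :
    evalWord a [s] = a s := rfl

theorem evalWord_cons_concat {ι σ : Type} [Fintype ι] (a : σ → Matrix ι ι TT) (h : σ)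
    (t : List σ) (s : σ) :
    evalWord a (h :: (t ++ [s])) = tmul (evalWord a (h :: t)) (a s) := by
  simp [evalWord]

theorem evalWordB_cons_concat {σ : Type} (a : σ → ℕ × ℕ) (h : σ) (t : List σ) (s : σ) :
    evalWordB a (h :: (t ++ [s])) = bmul (evalWordB a (h :: t)) (a s) := by
  simp [evalWordB]

theorem nonempty_word_induction {σ : Type} {P : (w : List σ) → w ≠ [] → Prop}
    (singleton : ∀ s, P [s] (List.cons_ne_nil s []))
    (concat : ∀ h t s, P (h :: t) (List.cons_ne_nil h t) →
      P (h :: (t ++ [s])) (List.cons_ne_nil h (t ++ [s])))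
    (w : List σ) (hw : w ≠ []) : P w hw := by
  cases w with
  | nil => exact absurd rfl hw
  | cons h t =>
    induction t using List.reverseRecOn with
    | nil => exact singleton h
    | append_singleton t s ih => exact concat h t s (ih (List.cons_ne_nil h t))

theorem evalWord_mono {ι σ : Type} [Fintype ι] {a b : σ → Matrix ι ι TT}
    (hab : ∀ s i j, a s i j ≤ b s i j) (w : List σ) (hw : w ≠ []) :
    ∀ i j, evalWord a w i j ≤ evalWord b w i j := by
  induction w, hw using nonempty_word_induction with
  | singleton s => exact hab s
  | concat h t s ih =>
    intro i j
    rw [evalWord_cons_concat, evalWord_cons_concat]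
    exact Finset.sup_mono_fun fun k _ => add_le_add (ih i k) (hab s k j)

theorem evalWord_eventuallyBelow {ι σ : Type} [Fintype ι] {A : ℕ → σ → Matrix ι ι TT}
    {a : σ → Matrix ι ι TT} (hA : ∀ s i j, EventuallyBelow (fun n => A n s i j) (a s i j))
    (w : List σ) (hw : w ≠ []) :
    ∀ i j, EventuallyBelow (fun n => evalWord (A n) w i j) (evalWord a w i j) := by
  induction w, hw using nonempty_word_induction with
  | singleton s => exact hA s
  | concat h t s ih =>
    intro i j
    simp only [evalWord_cons_concat]
    exact EventuallyBelow.sup fun k => (ih i k).add (hA s k j)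

theorem evalWord_map {ι σ : Type} [Fintype ι] {f : TT → TT} (hf : Monotone f) (hbot : f ⊥ = ⊥)
    (hadd : ∀ x y, f (x + y) = f x + f y) (a : σ → Matrix ι ι TT) (w : List σ) (hw : w ≠ []) :
    ∀ i j, evalWord (fun s => (a s).map f) w i j = f (evalWord a w i j) := by
  induction w, hw using nonempty_word_induction with
  | singleton s => exact fun _ _ => rfl
  | concat h t s ih =>
    intro i j
    simp only [evalWord_cons_concat, tmul]
    rw [Finset.apply_sup_eq_sup_comp_of_linearOrder f hf hbot]
    exact Finset.sup_congr rfl fun k _ => by simp [hadd, ih i k]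

/-- Rescaling the letters and conjugating by a diagonal matrix changes the value of a word
accordingly. -/
theorem evalWord_add_coe {ι σ : Type} [Fintype ι] (a : σ → Matrix ι ι TT) (c : σ → ℝ)
    (d : ι → ℝ) (w : List σ) (hw : w ≠ []) :
    ∀ i j, evalWord (fun s => .of fun i j => a s i j + ((c s + d i - d j : ℝ) : TT)) w i j =
      evalWord a w i j + (((w.map c).sum + d i - d j : ℝ) : TT) := by
  induction w, hw using nonempty_word_induction with
  | singleton s => intro i j; simp [evalWord_singleton]
  | concat h t s ih =>
    intro i j
    simp only [evalWord_cons_concat, tmul]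
    rw [Finset.apply_sup_eq_sup_comp_of_linearOrder
      (fun x : TT => x + (((((h :: (t ++ [s])).map c).sum + d i - d j : ℝ)) : TT))
      (fun x y hxy => by dsimp only; gcongr) (WithBot.bot_add _)]
    refine Finset.sup_congr rfl fun k _ => ?_
    simp only [ih i k, Function.comp, Matrix.of_apply]
    rw [add_add_add_comm, ← WithBot.coe_add]
    congr 2
    simp only [List.map_cons, List.map_append, List.sum_cons, List.sum_append, List.map_nil,
      List.sum_nil]
    ring

/-- The faithful representation of the bicyclic monoid by tropical matrices. -/
def bicyclicMatrix (p : ℕ × ℕ) : Matrix (Fin 2) (Fin 2) TT :=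
  !![(((p.1 : ℝ) - p.2 : ℝ) : TT), ((p.1 : ℝ) : TT); ⊥, ((0 : ℝ) : TT)]

theorem bicyclicMatrix_injective : Function.Injective bicyclicMatrix := by
  rintro ⟨a, b⟩ ⟨c, d⟩ h
  have h₀ := congrFun (congrFun h 0) 0
  have h₁ := congrFun (congrFun h 0) 1
  simp only [bicyclicMatrix, Matrix.of_apply, Matrix.cons_val', Matrix.cons_val_zero,
    Matrix.cons_val_one, Matrix.cons_val_fin_one, WithBot.coe_inj] at h₀ h₁
  have hac : a = c := by exact_mod_cast h₁
  subst hac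
  have hbd : (b : ℝ) = d := by linarith
  exact Prod.ext rfl (by exact_mod_cast hbd)

theorem bicyclicMatrix_bmul (p q : ℕ × ℕ) :
    bicyclicMatrix (bmul p q) = tmul (bicyclicMatrix p) (bicyclicMatrix q) := by
  obtain ⟨a, b⟩ := p
  obtain ⟨c, d⟩ := q
  have hb : ((max b c - b : ℕ) : ℝ) = max b c - b := by
    rw [Nat.cast_sub (le_max_left b c), Nat.cast_max]
  have hc : ((max b c - c : ℕ) : ℝ) = max b c - c := by
    rw [Nat.cast_sub (le_max_right b c), Nat.cast_max]
  have huniv (f : Fin 2 → TT) : Finset.univ.sup f = f 0 ⊔ f 1 := by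
    rw [show (Finset.univ : Finset (Fin 2)) = {0, 1} from rfl, Finset.sup_insert,
      Finset.sup_singleton]
  ext i j
  fin_cases i <;> fin_cases j
  · simp [bicyclicMatrix, bmul, tmul, huniv, hb, hc]
    rw [← WithBot.coe_add, WithBot.coe_inj]
    ring
  · have h : (a : ℝ) + (max (b : ℝ) c - b) = max ((a : ℝ) - b + c) a := by
      rcases le_total (b : ℝ) c with hbc | hbc
      · rw [max_eq_right hbc, max_eq_left (by linarith)]
        ring
      · rw [max_eq_left hbc, max_eq_right (by linarith)]
        ring
    simpa [bicyclicMatrix, bmul, tmul, huniv, hb, hc] using congrArg WithBot.some h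
  · simp [bicyclicMatrix, bmul, tmul, huniv]
  · simp [bicyclicMatrix, bmul, tmul, huniv]

theorem evalWord_bicyclicMatrix {σ : Type} (a : σ → ℕ × ℕ) (w : List σ) (hw : w ≠ []) :
    evalWord (fun s => bicyclicMatrix (a s)) w = bicyclicMatrix (evalWordB a w) := by
  induction w, hw using nonempty_word_induction with
  | singleton s => rfl
  | concat h t s ih =>
    rw [evalWord_cons_concat, evalWordB_cons_concat, bicyclicMatrix_bmul, ih]

theorem evalWordB_zero_left {σ : Type} (n : σ → ℕ) (w : List σ) (hw : w ≠ []) :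
    evalWordB (fun s => (0, n s)) w = (0, (w.map n).sum) := by
  induction w, hw using nonempty_word_induction with
  | singleton s => simp [evalWordB]
  | concat h t s ih =>
    rw [evalWordB_cons_concat, ih]
    simp [bmul]
    ring

theorem sum_map_eq_of_bicyclic {σ : Type} {w v : List σ} (hw : w ≠ []) (hv : v ≠ [])
    (h : ∀ a : σ → ℕ × ℕ, evalWordB a w = evalWordB a v) (q : σ → ℤ) :
    (w.map fun s => (q s : ℝ)).sum = (v.map fun s => (q s : ℝ)).sum := by
  have hnat (n : σ → ℕ) : (w.map n).sum = (v.map n).sum := by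
    simpa [evalWordB_zero_left n w hw, evalWordB_zero_left n v hv] using h fun s => (0, n s)
  have hsplit (u : List σ) : (u.map fun s => (q s : ℝ)).sum =
      ((u.map fun s => (q s).toNat).sum : ℝ) - ((u.map fun s => (-q s).toNat).sum : ℝ) := by
    induction u with
    | nil => simp
    | cons s u ih =>
      have hs : ((q s : ℤ) : ℝ) = ((q s).toNat : ℝ) - ((-q s).toNat : ℝ) := by
        exact_mod_cast (Int.toNat_sub_toNat_neg (q s)).symm
      simp only [List.map_cons, List.sum_cons, Nat.cast_add, ih, hs]
      ring
  rw [hsplit, hsplit, hnat, hnat]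

theorem evalWord_int_eq_of_bicyclic {σ : Type} [Fintype σ] {w v : List σ} (hw : w ≠ [])
    (hv : v ≠ []) (h : ∀ a : σ → ℕ × ℕ, evalWordB a w = evalWordB a v) (p r q : σ → ℤ) :
    evalWord (fun s => !![((p s : ℝ) : TT), ((r s : ℝ) : TT); ⊥, ((q s : ℝ) : TT)]) w =
      evalWord (fun s => !![((p s : ℝ) : TT), ((r s : ℝ) : TT); ⊥, ((q s : ℝ) : TT)]) v := by
  obtain ⟨C, hC⟩ : ∃ C : ℤ, ∀ s, |r s - q s| + |r s - p s| ≤ C :=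
    ⟨∑ s, (|r s - q s| + |r s - p s|), fun s =>
      Finset.single_le_sum (f := fun s => |r s - q s| + |r s - p s|)
        (fun _ _ => by positivity) (Finset.mem_univ s)⟩
  have hq (s : σ) : (((r s - q s + C).toNat : ℕ) : ℝ) = r s - q s + C := by
    have : (((r s - q s + C).toNat : ℕ) : ℤ) = r s - q s + C :=
      Int.toNat_of_nonneg (by
        linarith [hC s, neg_abs_le (r s - q s), abs_nonneg (r s - p s)])
    exact_mod_cast this
  have hp (s : σ) : (((r s - p s + C).toNat : ℕ) : ℝ) = r s - p s + C := by
    have : (((r s - p s + C).toNat : ℕ) : ℤ) = r s - p s + C :=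
      Int.toNat_of_nonneg (by
        linarith [hC s, neg_abs_le (r s - p s), abs_nonneg (r s - q s)])
    exact_mod_cast this
  have hA : (fun s => !![((p s : ℝ) : TT), ((r s : ℝ) : TT); ⊥, ((q s : ℝ) : TT)]) =
      fun s => .of fun i j => bicyclicMatrix ((r s - q s + C).toNat, (r s - p s + C).toNat) i j +
        (((q s : ℝ) + ![-(C : ℝ), 0] i - ![-(C : ℝ), 0] j : ℝ) : TT) := by
    refine funext fun s => Matrix.ext fun i j => ?_
    fin_cases i <;> fin_cases j
    · simp [bicyclicMatrix, hp, hq, ← WithBot.coe_add]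
    · simp [bicyclicMatrix, hp, hq, ← WithBot.coe_add]
      ring
    · simp [bicyclicMatrix]
    · simp [bicyclicMatrix]
  rw [hA]
  ext i j
  rw [evalWord_add_coe _ _ _ w hw, evalWord_add_coe _ _ _ v hv, evalWord_bicyclicMatrix _ w hw,
    evalWord_bicyclicMatrix _ v hv, h, sum_map_eq_of_bicyclic hw hv h]

/-- The integer numerator of an approximation from above to `x` with denominator `n + 1`. -/
noncomputable def approxNum (n : ℕ) : TT → ℤ
  | ⊥ => -(n * (n + 1))
  | (x : ℝ) => ⌈x * (n + 1)⌉

theorem le_approxNum (n : ℕ) (x : TT) : x ≤ ((approxNum n x / (n + 1) : ℝ) : TT) := by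
  induction x using WithBot.recBotCoe with
  | bot => exact bot_le
  | coe x =>
    rw [WithBot.coe_le_coe, le_div_iff₀ (by positivity)]
    exact Int.le_ceil _

theorem eventuallyBelow_approxNum (x : TT) :
    EventuallyBelow (fun n => ((approxNum n x / (n + 1) : ℝ) : TT)) x := by
  intro t ht
  induction x using WithBot.recBotCoe with
  | bot =>
    obtain ⟨N, hN⟩ := exists_nat_gt (-t)
    filter_upwards [Filter.eventually_ge_atTop N] with n hn
    have hn' : (N : ℝ) ≤ n := by exact_mod_cast hn
    rw [WithBot.coe_lt_coe, div_lt_iff₀ (by positivity)]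
    have : ((approxNum n ⊥ : ℤ) : ℝ) = -(n * (n + 1)) := by
      simp only [approxNum]; push_cast; ring
    rw [this, ← neg_mul]
    exact mul_lt_mul_of_pos_right (by linarith) (by positivity)
  | coe x =>
    have hxt : x < t := WithBot.coe_lt_coe.1 ht
    obtain ⟨N, hN⟩ := exists_nat_gt (1 / (t - x))
    filter_upwards [Filter.eventually_ge_atTop N] with n hn
    have hn' : (N : ℝ) ≤ n := by exact_mod_cast hn
    rw [WithBot.coe_lt_coe, div_lt_iff₀ (by positivity)]
    have h₁ : ((approxNum n (x : TT) : ℤ) : ℝ) < x * (n + 1) + 1 := Int.ceil_lt_add_one _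
    have h₂ : 1 < N * (t - x) := (div_lt_iff₀ (by linarith)).1 hN
    nlinarith

theorem evalWord_le_of_bicyclic {σ : Type} [Fintype σ] {w v : List σ} (hw : w ≠ [])
    (hv : v ≠ []) (h : ∀ a : σ → ℕ × ℕ, evalWordB a w = evalWordB a v)
    (a : σ → Matrix (Fin 2) (Fin 2) TT) (ha : ∀ s, IsUT (a s)) (i j : Fin 2) :
    evalWord a v i j ≤ evalWord a w i j := by
  let B (n : ℕ) (s : σ) : Matrix (Fin 2) (Fin 2) TT :=
    !![((approxNum n (a s 0 0) : ℝ) : TT), ((approxNum n (a s 0 1) : ℝ) : TT);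
      ⊥, ((approxNum n (a s 1 1) : ℝ) : TT)]
  let f (n : ℕ) : TT → TT := WithBot.map fun x : ℝ => x / (n + 1)
  let A (n : ℕ) (s : σ) : Matrix (Fin 2) (Fin 2) TT := (B n s).map (f n)
  have ha₁ (s : σ) : a s 1 0 = ⊥ := ha s 1 0 (by decide)
  have hA (s : σ) (i j : Fin 2) :
      EventuallyBelow (fun n => A n s i j) (a s i j) ∧ ∀ n, a s i j ≤ A n s i j := by
    fin_cases i <;> fin_cases j
    · exact ⟨eventuallyBelow_approxNum _, fun n => le_approxNum n _⟩
    · exact ⟨eventuallyBelow_approxNum _, fun n => le_approxNum n _⟩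
    · change EventuallyBelow (fun _ => ⊥) (a s 1 0) ∧ ∀ n : ℕ, a s 1 0 ≤ ⊥
      rw [ha₁]
      exact ⟨eventuallyBelow_const _, fun _ => le_rfl⟩
    · exact ⟨eventuallyBelow_approxNum _, fun n => le_approxNum n _⟩
  have hf (n : ℕ) : Monotone (f n) :=
    Monotone.withBot_map fun x y hxy => by gcongr
  have hadd (n : ℕ) (x y : TT) : f n (x + y) = f n x + f n y := by
    induction x using WithBot.recBotCoe with
    | bot => rfl
    | coe x =>
      induction y using WithBot.recBotCoe with
      | bot => rfl
      | coe y => exact congrArg WithBot.some (add_div x y _)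
  have hAeq (n : ℕ) : evalWord (A n) w i j = evalWord (A n) v i j := by
    rw [evalWord_map (hf n) rfl (hadd n) _ w hw, evalWord_map (hf n) rfl (hadd n) _ v hv,
      evalWord_int_eq_of_bicyclic hw hv h]
  by_contra! hlt
  obtain ⟨t, ht₁, ht₂⟩ := exists_between hlt
  lift t to ℝ using (bot_le.trans_lt ht₁).ne'
  obtain ⟨n, hn⟩ :=
    (evalWord_eventuallyBelow (fun s i j => (hA s i j).1) w hw i j t ht₁).exists
  exact (ht₂.trans_le (evalWord_mono (fun s i j => (hA s i j).2 n) v hv i j)).not_gt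
    ((hAeq n).symm.trans_lt hn)

theorem bicyclic_of_nat {σ : Type} [Fintype σ] {w v : List σ} (hw : w ≠ []) (hv : v ≠ [])
    (h : ∀ a : σ → Matrix (Fin 2) (Fin 2) TT, (∀ s, IsUT (a s)) →
      (∀ s i j, i ≤ j → a s i j ∈ Snat) → evalWord a w = evalWord a v)
    (a : σ → ℕ × ℕ) : evalWordB a w = evalWordB a v := by
  let C : ℕ := ∑ s, (a s).2
  have hC (s : σ) : (a s).2 ≤ C :=
    Finset.single_le_sum (f := fun s => (a s).2) (fun _ _ => Nat.zero_le _) (Finset.mem_univ s)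
  let d : Fin 2 → ℝ := fun _ => 0
  have key := h (fun s => .of fun i j => bicyclicMatrix (a s) i j + (((C : ℝ) + d i - d j : ℝ) : TT))
    (fun s i j hij => by
      fin_cases i <;> fin_cases j <;> simp_all [bicyclicMatrix])
    (fun s i j hij => by
      have := hC s
      fin_cases i <;> fin_cases j
      · refine ⟨(a s).1 + (C - (a s).2), ?_⟩
        simp [bicyclicMatrix, d, ← WithBot.coe_add, Nat.cast_sub this]
        ring
      · refine ⟨(a s).1 + C, ?_⟩
        simp [bicyclicMatrix, d]
      · simp at hij
      · refine ⟨C, ?_⟩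
        simp [bicyclicMatrix, d])
  have key' (i j : Fin 2) := congrFun (congrFun key i) j
  simp only [evalWord_add_coe _ _ _ w hw, evalWord_add_coe _ _ _ v hv,
    evalWord_bicyclicMatrix _ w hw, evalWord_bicyclicMatrix _ v hv] at key'
  have hlen := key' 1 1
  simp only [bicyclicMatrix, Matrix.of_apply, Matrix.cons_val', Matrix.cons_val_one,
    Matrix.cons_val_fin_one, ← WithBot.coe_add, WithBot.coe_inj, d, add_zero, sub_zero,
    zero_add] at hlen
  refine bicyclicMatrix_injective (Matrix.ext fun i j => ?_)
  have := key' i j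
  rw [hlen] at this
  exact WithBot.add_right_cancel WithBot.coe_ne_bot this

/-- Let `X` be any one of `ℚ`, `ℤ`, `ℕ₀`, `ℚ ∪ {-∞}`, `ℤ ∪ {-∞}`,
`ℕ₀ ∪ {-∞}`, and let `UT_2(X)` be the subsemigroup of `UT_2(𝕋)` of matrices whose entries on
and above the diagonal lie in `X`. Then `UT_2(X)` satisfies exactly the same semigroup
identities as the bicyclic monoid `ℬ` and as `UT_2(𝕋)`. -/
theorem stmt_11 (X : Set TT)
    (hX : X = Srat ∨ X = Sint ∨ X = Snat ∨
      X = insert ⊥ Srat ∨ X = insert ⊥ Sint ∨ X = insert ⊥ Snat)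
    (σ : Type) [Fintype σ] (w v : List σ) (hw : w ≠ []) (hv : v ≠ []) :
    ((∀ a : σ → Matrix (Fin 2) (Fin 2) TT, (∀ s, IsUT (a s)) →
        (∀ s i j, i ≤ j → a s i j ∈ X) → evalWord a w = evalWord a v)
      ↔ (∀ a : σ → ℕ × ℕ, evalWordB a w = evalWordB a v))
    ∧ ((∀ a : σ → Matrix (Fin 2) (Fin 2) TT, (∀ s, IsUT (a s)) →
        (∀ s i j, i ≤ j → a s i j ∈ X) → evalWord a w = evalWord a v)
      ↔ (∀ a : σ → Matrix (Fin 2) (Fin 2) TT, (∀ s, IsUT (a s)) →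
          evalWord a w = evalWord a v)) := by
  have hsub : Snat ⊆ X := by
    have hSrat : Snat ⊆ Srat := fun x ⟨m, hm⟩ => ⟨m, by simpa using hm⟩
    have hSint : Snat ⊆ Sint := fun x ⟨m, hm⟩ => ⟨m, by simpa using hm⟩
    rcases hX with rfl | rfl | rfl | rfl | rfl | rfl
    · exact hSrat
    · exact hSint
    · exact subset_rfl
    · exact hSrat.trans (Set.subset_insert _ _)
    · exact hSint.trans (Set.subset_insert _ _)
    · exact Set.subset_insert _ _
  have toB (h : ∀ a : σ → Matrix (Fin 2) (Fin 2) TT, (∀ s, IsUT (a s)) →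
      (∀ s i j, i ≤ j → a s i j ∈ X) → evalWord a w = evalWord a v) :
      ∀ a : σ → ℕ × ℕ, evalWordB a w = evalWordB a v :=
    bicyclic_of_nat hw hv fun a ha haX => h a ha fun s i j hij => hsub (haX s i j hij)
  have ofB (h : ∀ a : σ → ℕ × ℕ, evalWordB a w = evalWordB a v)
      (a : σ → Matrix (Fin 2) (Fin 2) TT) (ha : ∀ s, IsUT (a s)) :
      evalWord a w = evalWord a v :=
    Matrix.ext fun i j => le_antisymm
      (evalWord_le_of_bicyclic hv hw (fun b => (h b).symm) a ha i j)
      (evalWord_le_of_bicyclic hw hv h a ha i j)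
  exact ⟨⟨toB, fun h a ha _ => ofB h a ha⟩, ⟨fun h => ofB (toB h), fun h a ha _ => h a ha⟩⟩
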